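/- The following identity between two convergent series holds: Σ_{n=1}^{∞} (16/27)^n · [(1)_n^3 / ((1/2)_n (1/3)_n (2/3)_n)] · (11n−3)/n³ = 16 · Σ_{n=1}^{∞} 4^{−n} · [(1)_n^3 / ((1/2)_n)^3] · (3n−1)/n³. -/

import Mathlib

open Real

/-- Rising factorial `(a)ₙ = a(a+1)⋯(a+n−1)`. -/
noncomputable def pochR (a : ℝ) (n : ℕ) : ℝ := ∏ i ∈ Finset.range n, (a + i)

/-- The general term of the left-hand series (for `n ≥ 1`). -/
noncomputable def lhsTerm (n : ℕ) : ℝ :=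
  (16/27 : ℝ)^n * (pochR 1 n ^ 3 /
    (pochR (1/2) n * pochR (1/3) n * pochR (2/3) n)) * (11*(n : ℝ) - 3) / (n : ℝ)^3

/-- The general term of the right-hand series (for `n ≥ 1`). -/
noncomputable def rhsTerm (n : ℕ) : ℝ :=
  (1 / 4^n : ℝ) * (pochR 1 n ^ 3 / (pochR (1/2) n)^3) * (3*(n : ℝ) - 1) / (n : ℝ)^3


/-- WZ summation principle. -/
lemma wz_hasSum (F G : ℕ → ℕ → ℝ) (C w : ℕ → ℝ) (hw : Summable w)
    (hF : ∀ n k, |F n k| ≤ C n * w k) (hC : Filter.Tendsto C Filter.atTop (nhds 0))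
    (hG : ∀ n, Filter.Tendsto (G n) Filter.atTop (nhds 0))
    (hpos : ∀ n, 0 ≤ G n 0)
    (hWZ : ∀ n k, F (n+1) k - F n k = G n (k+1) - G n k) :
    HasSum (fun n => G n 0) (∑' k, F 0 k) := by
  have hs : ∀ n, Summable (F n) := fun n =>
    Summable.of_norm_bounded (hw.mul_left (C n)) (fun k => by simpa using hF n k)
  have hD : ∀ n, G n 0 = (∑' k, F n k) - ∑' k, F (n+1) k := by
    intro n
    have h1 := ((hs (n+1)).hasSum.sub (hs n).hasSum).tendsto_sum_nat
    have h2 : ∀ K, ∑ k ∈ Finset.range K, (F (n+1) k - F n k) = G n K - G n 0 := by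
      intro K
      rw [Finset.sum_congr rfl (fun k _ => hWZ n k), Finset.sum_range_sub]
    simp only [h2] at h1
    have h3 := tendsto_nhds_unique h1 ((hG n).sub_const (G n 0))
    linarith
  have hD0 : Filter.Tendsto (fun n => ∑' k, F n k) Filter.atTop (nhds 0) := by
    have h0 : Filter.Tendsto (fun n => C n * ∑' k, w k) Filter.atTop (nhds 0) := by
      simpa using hC.mul_const (∑' k, w k)
    refine squeeze_zero_norm (fun n => ?_) h0
    exact tsum_of_norm_bounded (hw.hasSum.mul_left (C n)) (fun k => by simpa using hF n k)
  rw [hasSum_iff_tendsto_nat_of_nonneg hpos]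
  have h4 : ∀ N, ∑ n ∈ Finset.range N, G n 0 = (∑' k, F 0 k) - ∑' k, F N k := by
    intro N
    rw [Finset.sum_congr rfl (fun n _ => hD n)]
    exact Finset.sum_range_sub' (fun n => ∑' k, F n k) N
  simp only [h4]
  simpa using hD0.const_sub (∑' k, F 0 k)

/-- The weight `1/(k+1/2)^2`. -/
noncomputable def wgt (k : ℕ) : ℝ := 1 / ((k : ℝ) + 1/2)^2

lemma wgt_summable : Summable wgt := by
  rw [← summable_nat_add_iff 1]
  have h := (summable_nat_add_iff 1).2 (Real.summable_one_div_nat_pow.2 (show 1 < 2 by norm_num))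
  refine Summable.of_nonneg_of_le (fun k => by unfold wgt; positivity) (fun k => ?_) h
  unfold wgt
  push_cast
  have hk : (0:ℝ) ≤ k := k.cast_nonneg
  exact one_div_le_one_div_of_le (by positivity) (by nlinarith)

lemma wgt_pos (k : ℕ) : 0 < wgt k := by unfold wgt; positivity

lemma tendsto_s : Filter.Tendsto (fun k : ℕ => (k : ℝ) + 1/2) Filter.atTop Filter.atTop :=
  Filter.tendsto_atTop_add_const_right _ _ tendsto_natCast_atTop_atTop

/-- Product of ratios. -/
lemma prod_bound (q : ℕ → ℝ) (h : ∀ k : ℕ, |q k| ≤ ((k:ℝ)+1/2)^2 / ((k:ℝ)+3/2)^2) (k : ℕ) :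
    4 * |∏ i ∈ Finset.range k, q i| ≤ wgt k := by
  induction k with
  | zero => norm_num [wgt]
  | succ k ih =>
    rw [Finset.prod_range_succ, abs_mul]
    calc 4 * (|∏ i ∈ Finset.range k, q i| * |q k|)
        = (4 * |∏ i ∈ Finset.range k, q i|) * |q k| := by ring
      _ ≤ wgt k * (((k:ℝ)+1/2)^2 / ((k:ℝ)+3/2)^2) :=
          mul_le_mul ih (h k) (abs_nonneg _) (wgt_pos k).le
      _ = wgt (k+1) := by unfold wgt; push_cast; field_simp; ring

lemma seq_tendsto (c r : ℕ → ℝ) (h0 : ∀ n, 0 < c n) (hc : ∀ n, c (n+1) = c n * r n)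
    (hr : ∀ n, r n ≤ 2/3) : Filter.Tendsto c Filter.atTop (nhds 0) := by
  have h : ∀ n, c n ≤ c 0 * (2/3)^n := by
    intro n
    induction n with
    | zero => simp
    | succ n ih =>
      rw [hc, pow_succ, ← mul_assoc]
      exact (mul_le_mul_of_nonneg_left (hr n) (h0 n).le).trans
        (mul_le_mul_of_nonneg_right ih (by norm_num))
  refine squeeze_zero (fun n => (h0 n).le) h ?_
  simpa using (tendsto_pow_atTop_nhds_zero_of_lt_one (by norm_num : (0:ℝ) ≤ 2/3)
    (by norm_num)).const_mul (c 0)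

/-- Ratio in `n` at `k = 0`, first pair. -/
noncomputable def r1 (n : ℕ) : ℝ := ((n:ℝ)+1)^3 / (2 * (2*(n:ℝ)+1) * ((n:ℝ)+3/2)^2)
/-- Ratio in `n` at `k = 0`, second pair. -/
noncomputable def r2 (n : ℕ) : ℝ :=
  8 * ((n:ℝ)+1)^3 * (2*(n:ℝ)+1) / (3 * (3*(n:ℝ)+2) * (3*(n:ℝ)+1) * ((n:ℝ)+3/2)^2)
noncomputable def c1 (n : ℕ) : ℝ := 4 * ∏ i ∈ Finset.range n, r1 i
noncomputable def c2 (n : ℕ) : ℝ := 4 * ∏ i ∈ Finset.range n, r2 i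

lemma r1_pos (n : ℕ) : 0 < r1 n := by unfold r1; positivity
lemma r2_pos (n : ℕ) : 0 < r2 n := by unfold r2; positivity
lemma c1_pos (n : ℕ) : 0 < c1 n := mul_pos (by norm_num) (Finset.prod_pos fun i _ => r1_pos i)
lemma c2_pos (n : ℕ) : 0 < c2 n := mul_pos (by norm_num) (Finset.prod_pos fun i _ => r2_pos i)
lemma c1_succ (n : ℕ) : c1 (n+1) = c1 n * r1 n := by
  unfold c1; rw [Finset.prod_range_succ]; ring
lemma c2_succ (n : ℕ) : c2 (n+1) = c2 n * r2 n := by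
  unfold c2; rw [Finset.prod_range_succ]; ring

lemma c1_tendsto : Filter.Tendsto c1 Filter.atTop (nhds 0) := by
  refine seq_tendsto c1 r1 c1_pos c1_succ (fun n => ?_)
  unfold r1
  have hn : (0:ℝ) ≤ n := n.cast_nonneg
  rw [div_le_iff₀ (by positivity)]
  have := pow_nonneg hn 3
  nlinarith [pow_nonneg hn 2]

lemma c2_tendsto : Filter.Tendsto c2 Filter.atTop (nhds 0) := by
  refine seq_tendsto c2 r2 c2_pos c2_succ (fun n => ?_)
  unfold r2
  have hn : (0:ℝ) ≤ n := n.cast_nonneg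
  rw [div_le_iff₀ (by positivity)]
  have := pow_nonneg hn 3
  have := pow_nonneg hn 4
  nlinarith [pow_nonneg hn 2]

noncomputable def q1 (n k : ℕ) : ℝ := ((k:ℝ)+1/2)^2 / ((k:ℝ)+(n:ℝ)+3/2)^2
noncomputable def q2 (n k : ℕ) : ℝ :=
  ((k:ℝ)+1/2) * ((k:ℝ)+1/2-n) / ((k:ℝ)+(n:ℝ)+3/2)^2

lemma q1_bound (n k : ℕ) : |q1 n k| ≤ ((k:ℝ)+1/2)^2 / ((k:ℝ)+3/2)^2 := by
  unfold q1
  rw [abs_of_nonneg (by positivity)]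
  have hn : (0:ℝ) ≤ n := n.cast_nonneg
  gcongr
  linarith

lemma q2_bound (n k : ℕ) : |q2 n k| ≤ ((k:ℝ)+1/2)^2 / ((k:ℝ)+3/2)^2 := by
  unfold q2
  have hn : (0:ℝ) ≤ n := n.cast_nonneg
  have hk : (0:ℝ) ≤ k := k.cast_nonneg
  generalize (n:ℝ) = x at *
  generalize (k:ℝ) = y at *
  rw [abs_div, abs_mul, abs_of_pos (show 0 < y + 1/2 by linarith),
    abs_of_pos (show 0 < (y + x + 3/2)^2 by positivity), div_le_div_iff₀ (by positivity) (by positivity)]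
  have key : |y+1/2-x| * (y+3/2)^2 ≤ (y+1/2) * (y+x+3/2)^2 := by
    rcases le_total 0 (y+1/2-x) with h | h
    · rw [abs_of_nonneg h]
      apply mul_le_mul <;> first | positivity | linarith | (gcongr; linarith)
    · rw [abs_of_nonpos h]
      have h1 := mul_nonneg hn hk
      have h2 := mul_nonneg h1 hk
      have h3 := mul_nonneg h1 hn
      have h4 := pow_nonneg hk 3
      nlinarith [sq_nonneg (x-1), sq_nonneg (y)]
  nlinarith [mul_le_mul_of_nonneg_left key (show 0 ≤ y+1/2 by linarith)]

noncomputable def F1 (n k : ℕ) : ℝ := c1 n * ∏ i ∈ Finset.range k, q1 n i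
noncomputable def F2 (n k : ℕ) : ℝ := c2 n * ∏ i ∈ Finset.range k, q2 n i

lemma F1_k (n k : ℕ) : F1 n (k+1) = F1 n k * q1 n k := by
  unfold F1; rw [Finset.prod_range_succ]; ring
lemma F2_k (n k : ℕ) : F2 n (k+1) = F2 n k * q2 n k := by
  unfold F2; rw [Finset.prod_range_succ]; ring

lemma F1_bound (n k : ℕ) : |F1 n k| ≤ c1 n * wgt k := by
  unfold F1
  rw [abs_mul, abs_of_pos (c1_pos n)]
  have := prod_bound _ (q1_bound n) k
  have h := abs_nonneg (∏ i ∈ Finset.range k, q1 n i)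
  exact mul_le_mul_of_nonneg_left (by linarith) (c1_pos n).le
lemma F2_bound (n k : ℕ) : |F2 n k| ≤ c2 n * wgt k := by
  unfold F2
  rw [abs_mul, abs_of_pos (c2_pos n)]
  have := prod_bound _ (q2_bound n) k
  have h := abs_nonneg (∏ i ∈ Finset.range k, q2 n i)
  exact mul_le_mul_of_nonneg_left (by linarith) (c2_pos n).le

lemma half_ne (n k : ℕ) : (k:ℝ)+1/2-n ≠ 0 := by
  intro h
  have h1 : ((2*k+1 : ℕ):ℝ) = ((2*n : ℕ):ℝ) := by push_cast; linarith
  have h2 : 2*k+1 = 2*n := by exact_mod_cast h1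
  omega

lemma half_ne' (n k : ℕ) : (k:ℝ)+1/2-(n+1) ≠ 0 := by
  have := half_ne (n+1) k
  push_cast at this; exact this

lemma F1_n (n k : ℕ) : F1 (n+1) k =
    F1 n k * (((n:ℝ)+1)^3 / (2 * (2*(n:ℝ)+1) * ((k:ℝ)+(n:ℝ)+3/2)^2)) := by
  induction k with
  | zero => simp [F1, c1_succ, r1]
  | succ k ih =>
    rw [F1_k, F1_k, ih]
    unfold q1
    push_cast
    have h1 : (k:ℝ)+(n:ℝ)+3/2 ≠ 0 := by positivity
    have h2 : (k:ℝ)+1+(n:ℝ)+3/2 ≠ 0 := by positivity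
    have h3 : (k:ℝ)+((n:ℝ)+1)+3/2 ≠ 0 := by positivity
    rw [show (k:ℝ)+((n:ℝ)+1)+3/2 = (k:ℝ)+1+(n:ℝ)+3/2 by ring]
    field_simp

lemma F2_n (n k : ℕ) : F2 (n+1) k =
    F2 n k * (-(4 * ((n:ℝ)+1)^3 * (2*(n:ℝ)+1)^2) /
      (3 * (3*(n:ℝ)+2) * (3*(n:ℝ)+1) * ((k:ℝ)+1/2-(n+1)) * ((k:ℝ)+(n:ℝ)+3/2)^2)) := by
  induction k with
  | zero =>
    simp only [F2, c2_succ, r2, Finset.range_zero, Finset.prod_empty, mul_one, Nat.cast_zero]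
    have h0 : (0:ℝ)+1/2-((n:ℝ)+1) = -(2*(n:ℝ)+1)/2 := by ring
    have h1 : 2*(n:ℝ)+1 ≠ 0 := by positivity
    rw [h0, zero_add]
    congr 1
    field_simp
    ring
  | succ k ih =>
    rw [F2_k, F2_k, ih]
    unfold q2
    push_cast
    have h1 : (k:ℝ)+(n:ℝ)+3/2 ≠ 0 := by positivity
    have h2 : (k:ℝ)+1+(n:ℝ)+3/2 ≠ 0 := by positivity
    have h4 := half_ne n k
    have h5 := half_ne' n k
    rw [show (k:ℝ)+((n:ℝ)+1)+3/2 = (k:ℝ)+1+(n:ℝ)+3/2 by ring,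
      show (k:ℝ)+1+1/2-((n:ℝ)+1) = (k:ℝ)+1/2-n by ring]
    generalize (k:ℝ)+1/2-((n:ℝ)+1) = u at *
    generalize (k:ℝ)+1/2-(n:ℝ) = v at *
    field_simp

noncomputable def G1 (n k : ℕ) : ℝ :=
  F1 n k * ((2*((k:ℝ)+1/2) + 3*(n:ℝ)+1) / (2*(2*(n:ℝ)+1)))

noncomputable def aa (n : ℕ) : ℝ := 1/(3*(n:ℝ)+1)
noncomputable def bb (n : ℕ) : ℝ := (2*((n:ℝ)+1)^2-4*((n:ℝ)+1)+1)/((3*(n:ℝ)+2)*(3*(n:ℝ)+1))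
noncomputable def gg (n : ℕ) : ℝ :=
  ((n:ℝ)+1)*(4*(2*(n:ℝ)+1)^2/(3*(3*(n:ℝ)+2)*(3*(n:ℝ)+1)) - 1)

noncomputable def G2 (n k : ℕ) : ℝ :=
  F2 n k * ((aa n * ((k:ℝ)+1/2)^2 + bb n * ((k:ℝ)+1/2) + gg n) / ((k:ℝ)+1/2-(n+1)))

lemma G1_wz (n k : ℕ) : F1 (n+1) k - F1 n k = G1 n (k+1) - G1 n k := by
  unfold G1
  rw [F1_k, F1_n]
  unfold q1
  push_cast
  have h1 : (k:ℝ)+(n:ℝ)+3/2 ≠ 0 := by positivity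
  field_simp
  ring

lemma G2_wz (n k : ℕ) : F2 (n+1) k - F2 n k = G2 n (k+1) - G2 n k := by
  unfold G2 aa bb gg
  rw [F2_k, F2_n]
  unfold q2
  push_cast
  have h1 : (k:ℝ)+(n:ℝ)+3/2 ≠ 0 := by positivity
  have h4 := half_ne n k
  have h5 := half_ne' n k
  rw [show (k:ℝ)+1+1/2-((n:ℝ)+1) = (k:ℝ)+1/2-n by ring]
  obtain ⟨u, hu⟩ : ∃ u, u = (k:ℝ)+1/2-((n:ℝ)+1) := ⟨_, rfl⟩
  have hk : (k:ℝ) = u + n + 1/2 := by linarith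
  rw [← hu] at h5 ⊢
  have h6 : (k:ℝ)+1/2-n = u+1 := by linarith
  rw [h6] at h4 ⊢
  rw [hk] at h1 ⊢
  have h7 : 3*(n:ℝ)+1 ≠ 0 := by positivity
  have h8 : 3*(n:ℝ)+2 ≠ 0 := by positivity
  have h9 : u+(n:ℝ)+1/2+n+3/2 = u+2*((n:ℝ)+1) := by ring
  rw [h9] at h1 ⊢
  generalize F2 n k = f
  obtain ⟨d, hd⟩ : ∃ d, d = u+2*((n:ℝ)+1) := ⟨_, rfl⟩
  rw [← hd] at h1 ⊢
  field_simp
  rw [hd]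
  ring

lemma G1_tendsto (n : ℕ) : Filter.Tendsto (G1 n) Filter.atTop (nhds 0) := by
  have hi := tendsto_inv_atTop_zero.comp tendsto_s
  have h := ((hi.const_mul 2).add ((hi.pow 2).const_mul (3*(n:ℝ)+1))).const_mul
    (c1 n / (2*(2*(n:ℝ)+1)))
  refine squeeze_zero_norm (fun k => ?_) (by simpa using h)
  unfold G1
  have hp : 0 < (k:ℝ)+1/2 := by positivity
  rw [Real.norm_eq_abs, abs_mul, abs_of_nonneg (a := (2*((k:ℝ)+1/2) + 3*(n:ℝ)+1) / (2*(2*(n:ℝ)+1))) (by positivity)]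
  refine (mul_le_mul_of_nonneg_right (F1_bound n k) (by positivity)).trans (le_of_eq ?_)
  unfold wgt
  field_simp
  try ring

lemma G2_tendsto (n : ℕ) : Filter.Tendsto (G2 n) Filter.atTop (nhds 0) := by
  have hi := tendsto_inv_atTop_zero.comp tendsto_s
  have hj := tendsto_inv_atTop_zero.comp
    (Filter.tendsto_atTop_add_const_right _ (-((n:ℝ)+1)) tendsto_s)
  have h := ((((hi.const_mul (bb n)).const_add (aa n)).add ((hi.pow 2).const_mul (gg n))).mul
    hj).abs.const_mul (c2 n)
  rw [mul_zero, abs_zero, mul_zero] at h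
  refine squeeze_zero_norm (fun k => ?_) h
  unfold G2
  have hp : (k:ℝ)+1/2 ≠ 0 := by positivity
  rw [Real.norm_eq_abs, abs_mul]
  refine (mul_le_mul_of_nonneg_right (F2_bound n k) (abs_nonneg _)).trans (le_of_eq ?_)
  rw [mul_assoc]
  conv_lhs => rw [← abs_of_pos (wgt_pos k), ← abs_mul]
  have h5 := half_ne' n k
  congr 2
  unfold wgt
  simp only [Function.comp, ← sub_eq_add_neg]
  generalize (k:ℝ)+1/2-((n:ℝ)+1) = u at *
  field_simp

lemma pochR_succ (a : ℝ) (n : ℕ) : pochR a (n+1) = pochR a n * (a + n) := by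
  unfold pochR; rw [Finset.prod_range_succ]

lemma pochR_pos (a : ℝ) (ha : 0 < a) (n : ℕ) : 0 < pochR a n :=
  Finset.prod_pos fun i _ => by positivity

lemma G1_zero (n : ℕ) : G1 n 0 = rhsTerm (n+1) := by
  have hc : c1 n * (3*(n:ℝ)+2) / (2*(2*(n:ℝ)+1)) = rhsTerm (n+1) := by
    induction n with
    | zero => norm_num [c1, rhsTerm, pochR]
    | succ n ih =>
      have e : c1 n = rhsTerm (n+1) * (2*(2*(n:ℝ)+1)) / (3*(n:ℝ)+2) := by
        rw [← ih]; field_simp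
      rw [c1_succ, e]
      unfold rhsTerm r1
      rw [pochR_succ 1 (n+1), pochR_succ (1/2) (n+1)]
      have p1 := pochR_pos 1 (by norm_num) (n+1)
      have p2 := pochR_pos (1/2) (by norm_num) (n+1)
      have hx : 3*((n:ℝ)+1)-1 = 3*n+2 := by ring
      push_cast
      rw [hx]
      field_simp
      ring
  rw [← hc]
  simp [G1, F1]
  ring

lemma G2_zero (n : ℕ) : G2 n 0 = lhsTerm (n+1) / 16 := by
  have hc : c2 n * ((11*(n:ℝ)+8) * (2*n+1) / (6*(3*(n:ℝ)+1)*(3*n+2))) = lhsTerm (n+1)/16 := by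
    induction n with
    | zero => norm_num [c2, lhsTerm, pochR]
    | succ n ih =>
      have e : c2 n = lhsTerm (n+1)/16 * (6*(3*(n:ℝ)+1)*(3*n+2)) / ((11*(n:ℝ)+8) * (2*n+1)) := by
        rw [← ih]; field_simp
      rw [c2_succ, e]
      unfold lhsTerm r2
      rw [pochR_succ 1 (n+1), pochR_succ (1/2) (n+1), pochR_succ (1/3) (n+1),
        pochR_succ (2/3) (n+1)]
      have p1 := pochR_pos 1 (by norm_num) (n+1)
      have p2 := pochR_pos (1/2) (by norm_num) (n+1)
      have p3 := pochR_pos (1/3) (by norm_num) (n+1)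
      have p4 := pochR_pos (2/3) (by norm_num) (n+1)
      have hx : 11*((n:ℝ)+1)-3 = 11*n+8 := by ring
      push_cast
      rw [hx]
      field_simp
      ring
  rw [← hc]
  simp only [G2, F2, aa, bb, gg, Finset.range_zero, Finset.prod_empty, mul_one, Nat.cast_zero]
  congr 1
  have h0 : (0:ℝ)+1/2-((n:ℝ)+1) = -(2*(n:ℝ)+1)/2 := by ring
  rw [h0]
  field_simp
  ring

lemma F1_zero_eq (k : ℕ) : F1 0 k = F2 0 k := by
  unfold F1 F2 c1 c2 q1 q2
  simp [pow_two]

theorem dual_series_identity :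
    Summable (fun n : ℕ => lhsTerm (n+1)) ∧ Summable (fun n : ℕ => rhsTerm (n+1)) ∧
    ∑' n : ℕ, lhsTerm (n+1) = 16 * ∑' n : ℕ, rhsTerm (n+1) := by
  have H1 := wz_hasSum F1 G1 c1 wgt wgt_summable F1_bound c1_tendsto G1_tendsto
    (fun n => by
      have := c1_pos n
      simp only [G1, F1, Finset.range_zero, Finset.prod_empty]
      positivity) G1_wz
  have H2 := wz_hasSum F2 G2 c2 wgt wgt_summable F2_bound c2_tendsto G2_tendsto
    (fun n => by
      rw [G2_zero]
      unfold lhsTerm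
      have p1 := pochR_pos 1 (by norm_num) (n+1)
      have p2 := pochR_pos (1/2) (by norm_num) (n+1)
      have p3 := pochR_pos (1/3) (by norm_num) (n+1)
      have p4 := pochR_pos (2/3) (by norm_num) (n+1)
      have hx : 11*(((n+1 : ℕ)):ℝ)-3 = 11*n+8 := by push_cast; ring
      rw [hx]
      positivity) G2_wz
  simp only [F1_zero_eq, G1_zero] at H1
  simp only [G2_zero] at H2
  have H3 := H2.mul_left 16
  have e : (fun n : ℕ => 16 * (lhsTerm (n+1) / 16)) = fun n => lhsTerm (n+1) := by
    funext n; ring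
  rw [e] at H3
  exact ⟨H3.summable, H1.summable, by rw [H3.tsum_eq, H1.tsum_eq]⟩
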